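/- arXiv:2505.09335 — 2 statements merged into one kernel-verified Lean document; each statement's English description precedes it below -/
import Mathlib

section
/- Let 1 < q < ∞ and let q' be the conjugate exponent of q. The discrete Hardy–Littlewood–Pólya operator 𝓗 defined by (𝓗a)(n) = Σ_{m=1}^∞ a_m / max{m,n} is bounded on l^q, and its operator norm ‖𝓗‖_{l^q→l^q} = sup_{a ∈ l^q, a ≠ 0} ‖𝓗a‖_q / ‖a‖_q equals q + q'. -/
open ENNReal

/-- The discrete Hardy–Littlewood–Pólya operator `(𝓗a)(n) = ∑_{m≥1} a_m / max{m,n}`. -/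
noncomputable def HLPdiscrete (a : ℕ+ → ℝ) (n : ℕ+) : ℝ :=
  ∑' m : ℕ+, a m / max (m : ℝ) (n : ℝ)

/-- The `ℓ^q`-norm of a sequence, valued in `ℝ≥0∞`. -/
noncomputable def lqNorm (q : ℝ) (a : ℕ+ → ℝ) : ℝ≥0∞ :=
  (∑' n : ℕ+, ENNReal.ofReal (|a n| ^ q)) ^ (1 / q)

theorem rpow_le_tangent {p x y : ℝ} (hp0 : 0 ≤ p) (hp1 : p ≤ 1) (hx : 0 < x) (hy : 0 ≤ y) :
    y ^ p ≤ x ^ p + p * x ^ (p - 1) * (y - x) := by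
  have hb := rpow_one_add_le_one_add_mul_self (s := y / x - 1)
    (by linarith [div_nonneg hy hx.le]) hp0 hp1
  rw [add_sub_cancel, Real.div_rpow hy hx.le, div_le_iff₀ (by positivity)] at hb
  rw [Real.rpow_sub_one hx.ne']
  refine hb.trans_eq ?_
  field_simp

theorem tangent_le_rpow_neg {s x y : ℝ} (hs0 : 0 ≤ s) (hs1 : s ≤ 1) (hx : 0 < x) (hy : 0 < y) :
    x ^ (-s) - s * x ^ (-s - 1) * (y - x) ≤ y ^ (-s) := by
  have ht := rpow_le_tangent hs0 hs1 hx hy.le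
  rw [Real.rpow_sub_one hx.ne'] at ht ⊢
  rw [Real.rpow_neg hx.le, Real.rpow_neg hy.le]
  have hX : 0 < x ^ s := by positivity
  have hY : 0 < y ^ s := by positivity
  set X := x ^ s
  set Y := y ^ s
  set t := s * ((y - x) / x) with ht_def
  have h1 : Y ≤ X * (1 + t) := by
    refine ht.trans_eq ?_
    rw [ht_def]; field_simp
  have h2 : X⁻¹ - s * (X⁻¹ / x) * (y - x) = X⁻¹ * (1 - t) := by
    rw [ht_def]; field_simp
  rw [h2, inv_mul_le_iff₀ hX, ← div_eq_mul_inv, le_div_iff₀ hY]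
  have h3 : 0 < 1 + t := by
    by_contra! h
    nlinarith
  rcases le_total 0 (1 - t) with h | h
  · calc (1 - t) * Y ≤ (1 - t) * (X * (1 + t)) := by gcongr
      _ = X - X * t ^ 2 := by ring
      _ ≤ X := by nlinarith [sq_nonneg t]
  · nlinarith

theorem sum_rpow_neg_le {s : ℝ} (hs0 : 0 < s) (hs1 : s < 1) (N : ℕ) :
    ∑ i ∈ Finset.range N, ((i : ℝ) + 1) ^ (-s) ≤ (N : ℝ) ^ (1 - s) / (1 - s) := by
  have hs : 0 < 1 - s := by linarith
  induction N with
  | zero => simp [Real.zero_rpow hs.ne']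
  | succ N ih =>
    have h := rpow_le_tangent (p := 1 - s) (x := N + 1) (y := N) hs.le (by linarith)
      (by positivity) (by positivity)
    rw [show (1 - s - 1) = -s by ring] at h
    rw [Finset.sum_range_succ]
    push_cast
    rw [le_div_iff₀ hs] at ih ⊢
    linarith

theorem le_sum_rpow_neg {s : ℝ} (hs0 : 0 < s) (hs1 : s < 1) (N : ℕ) :
    (((N : ℝ) + 1) ^ (1 - s) - 1) / (1 - s) ≤ ∑ i ∈ Finset.range N, ((i : ℝ) + 1) ^ (-s) := by
  have hs : 0 < 1 - s := by linarith
  induction N with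
  | zero => simp
  | succ N ih =>
    have h := rpow_le_tangent (p := 1 - s) (x := N + 1) (y := N + 1 + 1) hs.le (by linarith)
      (by positivity) (by positivity)
    rw [show (1 - s - 1) = -s by ring] at h
    rw [Finset.sum_range_succ]
    push_cast
    rw [div_le_iff₀ hs] at ih ⊢
    linarith

theorem sum_div_max_le {s : ℝ} (hs0 : 0 < s) (hs1 : s < 1) {n : ℕ} (hn : 0 < n) (N : ℕ) :
    ∑ i ∈ Finset.range N, ((i : ℝ) + 1) ^ (-s) / max ((i : ℝ) + 1) n
      ≤ (1 / (1 - s) + 1 / s) * (n : ℝ) ^ (-s) := by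
  have hs : 0 < 1 - s := by linarith
  have hn' : (0 : ℝ) < n := by exact_mod_cast hn
  have key (k : ℕ) : ∑ i ∈ Finset.range (n + k), ((i : ℝ) + 1) ^ (-s) / max ((i : ℝ) + 1) n
      ≤ (1 / (1 - s) + 1 / s) * (n : ℝ) ^ (-s) - ((n : ℝ) + k) ^ (-s) / s := by
    induction k with
    | zero =>
      have h : ∑ i ∈ Finset.range n, ((i : ℝ) + 1) ^ (-s) / max ((i : ℝ) + 1) n
          = (∑ i ∈ Finset.range n, ((i : ℝ) + 1) ^ (-s)) / n := by
        rw [Finset.sum_div]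
        refine Finset.sum_congr rfl fun i hi => ?_
        rw [max_eq_right]
        exact_mod_cast Finset.mem_range.1 hi
      rw [add_zero, h, Nat.cast_zero, add_zero, div_le_iff₀ hn']
      refine (sum_rpow_neg_le hs0 hs1 n).trans_eq ?_
      rw [show (1 - s) = -s + 1 by ring, Real.rpow_add_one hn'.ne']
      ring
    | succ k ih =>
      have h := tangent_le_rpow_neg hs0.le hs1.le (x := (n : ℝ) + k + 1) (y := (n : ℝ) + k)
        (by positivity) (by positivity)
      rw [← add_assoc, Finset.sum_range_succ]
      push_cast
      rw [max_eq_left (by linarith [(Nat.cast_nonneg k : (0 : ℝ) ≤ k)]), ← add_assoc,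
        ← Real.rpow_sub_one (by positivity)]
      have h' : ((n : ℝ) + k + 1) ^ (-s - 1)
          ≤ (((n : ℝ) + k) ^ (-s) - ((n : ℝ) + k + 1) ^ (-s)) / s := by
        rw [le_div_iff₀ hs0]
        linarith
      rw [sub_div] at h'
      linarith
  calc _ ≤ ∑ i ∈ Finset.range (n + N), ((i : ℝ) + 1) ^ (-s) / max ((i : ℝ) + 1) n := by
        refine Finset.sum_le_sum_of_subset_of_nonneg (Finset.range_subset_range.2 (by omega))
          fun _ _ _ => by positivity
    _ ≤ _ := (key N).trans (sub_le_self _ (by positivity))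

theorem le_sum_div_max {s : ℝ} (hs0 : 0 < s) (hs1 : s < 1) {n N : ℕ} (hn : 0 < n) (hN : n ≤ N) :
    (1 / (1 - s) + 1 / s) * (n : ℝ) ^ (-s) - (n : ℝ)⁻¹ / (1 - s) - ((N : ℝ) + 1) ^ (-s) / s
      ≤ ∑ i ∈ Finset.range N, ((i : ℝ) + 1) ^ (-s) / max ((i : ℝ) + 1) n := by
  have hs : 0 < 1 - s := by linarith
  obtain ⟨m, rfl⟩ : ∃ m, n = m + 1 := ⟨n - 1, by omega⟩
  obtain ⟨k, rfl⟩ : ∃ k, N = m + k := ⟨N - m, by omega⟩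
  clear hN
  have hn' : (0 : ℝ) < (m : ℝ) + 1 := by positivity
  push_cast
  induction k with
  | zero =>
    have h : ∑ i ∈ Finset.range m, ((i : ℝ) + 1) ^ (-s) / max ((i : ℝ) + 1) (m + 1)
        = (∑ i ∈ Finset.range m, ((i : ℝ) + 1) ^ (-s)) / (m + 1) := by
      rw [Finset.sum_div]
      refine Finset.sum_congr rfl fun i hi => ?_
      rw [max_eq_right]
      exact_mod_cast Nat.succ_le_succ (Finset.mem_range.1 hi).le
    rw [add_zero, h, Nat.cast_zero, add_zero, le_div_iff₀ hn']
    refine Eq.trans_le ?_ (le_sum_rpow_neg hs0 hs1 m)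
    rw [show (1 - s) = -s + 1 by ring, Real.rpow_add_one hn'.ne']
    field_simp
    ring
  | succ k ih =>
    have h := tangent_le_rpow_neg hs0.le hs1.le (x := (m : ℝ) + k + 1) (y := (m : ℝ) + k + 1 + 1)
      (by positivity) (by positivity)
    rw [← add_assoc, Finset.sum_range_succ]
    push_cast
    rw [max_eq_left (by linarith [(Nat.cast_nonneg k : (0 : ℝ) ≤ k)]),
      ← Real.rpow_sub_one (by positivity), ← add_assoc]
    have h' : (((m : ℝ) + k + 1) ^ (-s) - ((m : ℝ) + k + 1 + 1) ^ (-s)) / s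
        ≤ ((m : ℝ) + k + 1) ^ (-s - 1) := by
      rw [div_le_iff₀ hs0]
      linarith
    rw [sub_div] at h'
    linarith

theorem ENNReal.inner_le_Lp_mul_Lq_tsum {ι : Type*} {p q : ℝ} (hpq : p.HolderConjugate q)
    (f g : ι → ℝ≥0∞) :
    ∑' i, f i * g i ≤ (∑' i, f i ^ p) ^ (1 / p) * (∑' i, g i ^ q) ^ (1 / q) := by
  have hp := hpq.pos
  have hq := hpq.symm.pos
  rw [ENNReal.tsum_eq_iSup_sum]
  refine iSup_le fun t => (ENNReal.inner_le_Lp_mul_Lq t f g hpq).trans ?_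
  gcongr <;> exact ENNReal.sum_le_tsum t

/-- The Schur test with a matrix of nonnegative entries and weights `g`, `h`. -/
theorem ENNReal.tsum_rpow_tsum_mul_le {ι κ : Type*} {p q : ℝ} (hpq : p.HolderConjugate q)
    {K : ι → κ → ℝ≥0∞} {g : ι → ℝ≥0∞} {h : κ → ℝ≥0∞} {C : ℝ≥0∞}
    (h_ne_zero : ∀ j, h j ≠ 0) (h_ne_top : ∀ j, h j ≠ ∞)
    (hrow : ∀ i, ∑' j, K i j * h j ^ p ≤ C * g i ^ p)
    (hcol : ∀ j, ∑' i, K i j * g i ^ q ≤ C * h j ^ q) (a : κ → ℝ≥0∞) :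
    ∑' i, (∑' j, K i j * a j) ^ q ≤ C ^ q * ∑' j, a j ^ q := by
  have hp := hpq.pos
  have hq := hpq.symm.pos
  have hsum : 1 / p + 1 / q = 1 := by simpa using hpq.inv_add_inv_eq_one
  have hcancel (j : κ) : h j ^ q * (h j)⁻¹ ^ q = 1 := by
    rw [← ENNReal.mul_rpow_of_nonneg _ _ hq.le,
      ENNReal.mul_inv_cancel (h_ne_zero j) (h_ne_top j), ENNReal.one_rpow]
  have hpt (i : ι) : (∑' j, K i j * a j) ^ q
      ≤ C ^ (q / p) * ∑' j, K i j * g i ^ q * ((h j)⁻¹ ^ q * a j ^ q) := by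
    have e (j : κ) : K i j * a j
        = (K i j ^ (1 / p) * h j) * (K i j ^ (1 / q) * ((h j)⁻¹ * a j)) := by
      calc K i j * a j = K i j ^ (1 / p + 1 / q) * (h j * (h j)⁻¹) * a j := by
            rw [hsum, ENNReal.rpow_one, ENNReal.mul_inv_cancel (h_ne_zero j) (h_ne_top j), mul_one]
        _ = _ := by
            rw [ENNReal.rpow_add_of_nonneg _ _ (by positivity) (by positivity)]
            ring
    have e1 (j : κ) : (K i j ^ (1 / p) * h j) ^ p = K i j * h j ^ p := by
      rw [ENNReal.mul_rpow_of_nonneg _ _ hp.le, ← ENNReal.rpow_mul, one_div_mul_cancel hp.ne',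
        ENNReal.rpow_one]
    have e2 (j : κ) : (K i j ^ (1 / q) * ((h j)⁻¹ * a j)) ^ q
        = K i j * ((h j)⁻¹ ^ q * a j ^ q) := by
      rw [ENNReal.mul_rpow_of_nonneg _ _ hq.le, ENNReal.mul_rpow_of_nonneg _ _ hq.le,
        ← ENNReal.rpow_mul, one_div_mul_cancel hq.ne', ENNReal.rpow_one]
    have hH := ENNReal.inner_le_Lp_mul_Lq_tsum hpq (fun j => K i j ^ (1 / p) * h j)
      (fun j => K i j ^ (1 / q) * ((h j)⁻¹ * a j))
    simp_rw [e1, e2, ← e] at hH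
    calc (∑' j, K i j * a j) ^ q
        ≤ ((C * g i ^ p) ^ (1 / p) * (∑' j, K i j * ((h j)⁻¹ ^ q * a j ^ q)) ^ (1 / q)) ^ q := by
          refine ENNReal.rpow_le_rpow (hH.trans ?_) hq.le
          gcongr
          exact hrow i
      _ = C ^ (q / p) * (g i ^ q * ∑' j, K i j * ((h j)⁻¹ ^ q * a j ^ q)) := by
          rw [ENNReal.mul_rpow_of_nonneg _ _ hq.le, ENNReal.mul_rpow_of_nonneg _ _ (by positivity),
            ENNReal.mul_rpow_of_nonneg _ _ hq.le]
          simp_rw [← ENNReal.rpow_mul]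
          rw [mul_one_div_cancel hp.ne', one_mul, one_div_mul_cancel hq.ne', ENNReal.rpow_one,
            mul_assoc, one_div_mul_eq_div]
      _ = _ := by
          rw [← ENNReal.tsum_mul_left]
          congr 2
          ext j
          ring
  calc ∑' i, (∑' j, K i j * a j) ^ q
      ≤ ∑' i, C ^ (q / p) * ∑' j, K i j * g i ^ q * ((h j)⁻¹ ^ q * a j ^ q) :=
        ENNReal.tsum_le_tsum hpt
    _ = C ^ (q / p) * ∑' j, (∑' i, K i j * g i ^ q) * ((h j)⁻¹ ^ q * a j ^ q) := by
        rw [ENNReal.tsum_mul_left, ENNReal.tsum_comm]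
        simp_rw [ENNReal.tsum_mul_right]
    _ ≤ C ^ (q / p) * ∑' j, C * h j ^ q * ((h j)⁻¹ ^ q * a j ^ q) := by
        gcongr with j
        exact hcol j
    _ = C ^ (q / p) * C * ∑' j, a j ^ q := by
        rw [mul_assoc, ← ENNReal.tsum_mul_left (a := C)]
        congr 2
        ext j
        rw [mul_assoc, ← mul_assoc (h j ^ q), hcancel, one_mul]
    _ = C ^ q * ∑' j, a j ^ q := by
        congr 1
        nth_rw 2 [← ENNReal.rpow_one C]
        rw [← ENNReal.rpow_add_of_nonneg _ _ (by positivity) zero_le_one]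
        congr 1
        calc q / p + 1 = q * (1 / p + 1 / q) := by field_simp
          _ = q := by rw [hsum, mul_one]

theorem tsum_kernel_mul_rpow_le {s : ℝ} (hs0 : 0 < s) (hs1 : s < 1) (n : ℕ+) :
    ∑' m : ℕ+, ENNReal.ofReal (1 / max (m : ℝ) n) * ENNReal.ofReal ((m : ℝ) ^ (-s))
      ≤ ENNReal.ofReal (1 / (1 - s) + 1 / s) * ENNReal.ofReal ((n : ℝ) ^ (-s)) := by
  have hs : 0 < 1 - s := by linarith
  rw [tsum_pnat_eq_tsum_succ (f := fun m : ℕ =>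
    ENNReal.ofReal (1 / max (m : ℝ) n) * ENNReal.ofReal ((m : ℝ) ^ (-s))),
    ← ENNReal.ofReal_mul (by positivity)]
  refine ENNReal.tsum_le_of_sum_range_le fun N => ?_
  have e (i : ℕ) : ENNReal.ofReal (1 / max ((i + 1 : ℕ) : ℝ) n)
      * ENNReal.ofReal (((i + 1 : ℕ) : ℝ) ^ (-s))
      = ENNReal.ofReal (((i : ℝ) + 1) ^ (-s) / max ((i : ℝ) + 1) (n : ℕ)) := by
    rw [← ENNReal.ofReal_mul (by positivity)]
    push_cast
    rw [one_div_mul_eq_div]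
  simp_rw [e]
  rw [← ENNReal.ofReal_sum_of_nonneg fun _ _ => by positivity]
  exact ENNReal.ofReal_le_ofReal (sum_div_max_le hs0 hs1 n.pos N)

theorem lqNorm_HLPdiscrete_le {q q' : ℝ} (hqq' : q.HolderConjugate q') (a : ℕ+ → ℝ) :
    lqNorm q (HLPdiscrete a) ≤ ENNReal.ofReal (q + q') * lqNorm q a := by
  have hq := hqq'.pos
  have hq' := hqq'.symm.pos
  set h : ℕ+ → ℝ≥0∞ := fun n => ENNReal.ofReal ((n : ℝ) ^ (-(1 / (q * q')))) with h_def
  have hpow {r t : ℝ} (hr : 0 < r) (ht : 0 < t) (hrt : r * t = q * q') (n : ℕ+) :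
      h n ^ r = ENNReal.ofReal ((n : ℝ) ^ (-(1 / t))) := by
    rw [h_def, ENNReal.ofReal_rpow_of_nonneg (by positivity) hr.le, ← Real.rpow_mul (by positivity),
      ← hrt]
    congr 2
    field_simp
  have hconst {r t : ℝ} (hrt : r.HolderConjugate t) : 1 / (1 - 1 / r) + 1 / (1 / r) = r + t := by
    rw [one_div r, hrt.one_sub_inv]
    simp [add_comm]
  have hlt {r t : ℝ} (hrt : r.HolderConjugate t) : 1 / r < 1 := by
    rw [div_lt_one hrt.pos]; exact hrt.lt
  have hschur := ENNReal.tsum_rpow_tsum_mul_le hqq'.symm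
    (K := fun n m : ℕ+ => ENNReal.ofReal (1 / max (m : ℝ) n)) (g := h) (h := h)
    (C := ENNReal.ofReal (q + q'))
    (fun n => by
      have : (0 : ℝ) < n := by exact_mod_cast n.pos
      simp only [h_def, ne_eq, ENNReal.ofReal_eq_zero, not_le]
      positivity)
    (fun n => ENNReal.ofReal_ne_top)
    (fun n => by
      simp_rw [hpow hq' hq (mul_comm _ _)]
      rw [← hconst hqq']
      exact tsum_kernel_mul_rpow_le (by positivity) (hlt hqq') n)
    (fun m => by
      simp_rw [hpow hq hq' rfl, max_comm (m : ℝ)]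
      rw [add_comm q, ← hconst hqq'.symm]
      exact tsum_kernel_mul_rpow_le (by positivity) (hlt hqq'.symm) m)
    (fun m => ENNReal.ofReal |a m|)
  have hpt (n : ℕ+) : ENNReal.ofReal (|HLPdiscrete a n| ^ q)
      ≤ (∑' m : ℕ+, ENNReal.ofReal (1 / max (m : ℝ) n) * ENNReal.ofReal |a m|) ^ q := by
    rw [← ENNReal.ofReal_rpow_of_nonneg (abs_nonneg _) hq.le, ← Real.enorm_eq_ofReal_abs]
    refine ENNReal.rpow_le_rpow (enorm_tsum_le_tsum_enorm.trans_eq ?_) hq.le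
    congr 1
    ext m
    have : (0 : ℝ) ≤ max (m : ℝ) n := by positivity
    rw [Real.enorm_eq_ofReal_abs, abs_div, abs_of_nonneg this, ← ENNReal.ofReal_mul (by positivity),
      one_div_mul_eq_div]
  unfold lqNorm
  calc (∑' n, ENNReal.ofReal (|HLPdiscrete a n| ^ q)) ^ (1 / q)
      ≤ (ENNReal.ofReal (q + q') ^ q * ∑' m, ENNReal.ofReal |a m| ^ q) ^ (1 / q) := by
        gcongr
        exact (ENNReal.tsum_le_tsum hpt).trans hschur
    _ = _ := by
        rw [ENNReal.mul_rpow_of_nonneg _ _ (by positivity), ← ENNReal.rpow_mul,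
          mul_one_div_cancel hq.ne', ENNReal.rpow_one]
        simp_rw [ENNReal.ofReal_rpow_of_nonneg (abs_nonneg _) hq.le]

/-- The extremal family: the sequence `n ↦ n ^ (-s)` cut off after its first `N` terms. -/
noncomputable def truncatedPower (s : ℝ) (N : ℕ) (n : ℕ+) : ℝ :=
  if (n : ℕ) ≤ N then (n : ℝ) ^ (-s) else 0

theorem HLPdiscrete_truncatedPower (s : ℝ) (N : ℕ) (n : ℕ+) :
    HLPdiscrete (truncatedPower s N) n
      = ∑ i ∈ Finset.range N, ((i : ℝ) + 1) ^ (-s) / max ((i : ℝ) + 1) (n : ℕ) := by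
  unfold HLPdiscrete truncatedPower
  rw [tsum_pnat_eq_tsum_succ (f := fun m : ℕ =>
    (if m ≤ N then (m : ℝ) ^ (-s) else 0) / max (m : ℝ) n), tsum_eq_sum (s := Finset.range N)]
  · refine Finset.sum_congr rfl fun i hi => ?_
    rw [if_pos (Nat.succ_le_of_lt (Finset.mem_range.1 hi))]
    push_cast
    rfl
  · intro i hi
    rw [if_neg (by simpa using hi), zero_div]

theorem lqNorm_truncatedPower {q : ℝ} (hq : 0 < q) (N : ℕ) :
    lqNorm q (truncatedPower (1 / q) N)
      = ENNReal.ofReal ((∑ i ∈ Finset.range N, 1 / ((i : ℝ) + 1)) ^ (1 / q)) := by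
  unfold lqNorm truncatedPower
  rw [← ENNReal.ofReal_rpow_of_nonneg (Finset.sum_nonneg fun _ _ => by positivity) (by positivity)]
  congr 1
  rw [tsum_pnat_eq_tsum_succ (f := fun m : ℕ =>
    ENNReal.ofReal (|if m ≤ N then (m : ℝ) ^ (-(1 / q)) else 0| ^ q)),
    tsum_eq_sum (s := Finset.range N), ENNReal.ofReal_sum_of_nonneg fun _ _ => by positivity]
  · refine Finset.sum_congr rfl fun i hi => ?_
    rw [if_pos (Nat.succ_le_of_lt (Finset.mem_range.1 hi)), abs_of_nonneg (by positivity),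
      ← Real.rpow_mul (by positivity), neg_mul, one_div_mul_cancel hq.ne', Real.rpow_neg_one]
    simp
  · intro i hi
    rw [if_neg (by simpa using hi)]
    simp [hq.ne']

theorem le_lqNorm {q : ℝ} (hq : 0 < q) {b : ℕ+ → ℝ} {t : Finset ℕ} {f : ℕ → ℝ}
    (hf : ∀ i ∈ t, 0 ≤ f i) (hfb : ∀ i ∈ t, f i ≤ |b i.succPNat| ^ q) :
    ENNReal.ofReal ((∑ i ∈ t, f i) ^ (1 / q)) ≤ lqNorm q b := by
  unfold lqNorm
  rw [← ENNReal.ofReal_rpow_of_nonneg (Finset.sum_nonneg hf) (by positivity),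
    ← Equiv.pnatEquivNat.symm.tsum_eq, ENNReal.ofReal_sum_of_nonneg hf]
  gcongr
  exact (Finset.sum_le_sum fun i hi => ENNReal.ofReal_le_ofReal (hfb i hi)).trans
    (ENNReal.sum_le_tsum t)

/-- Away from both ends of its support, the truncated power is almost an eigenvector of the
Hardy–Littlewood–Pólya operator. -/
theorem exists_le_HLPdiscrete_truncatedPower {s c : ℝ} (hs0 : 0 < s) (hs1 : s < 1)
    (hc : c < 1 / (1 - s) + 1 / s) :
    ∃ n₀ k : ℕ, 0 < k ∧ ∀ (M : ℕ) (n : ℕ+), n₀ ≤ n → (n : ℕ) ≤ M →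
      c * (n : ℝ) ^ (-s) ≤ HLPdiscrete (truncatedPower s (k * M)) n := by
  have hs : 0 < 1 - s := by linarith
  set δ := 1 / (1 - s) + 1 / s - c with δ_def
  have hδ : 0 < δ := sub_pos.2 hc
  have htend {r e : ℝ} (hr : 0 < r) (he : 0 < e) :
      ∃ n₀ : ℕ, ∀ n : ℕ, n₀ ≤ n → (n : ℝ) ^ (-r) ≤ e := by
    have h := (tendsto_rpow_neg_atTop hr).comp tendsto_natCast_atTop_atTop
    exact Filter.eventually_atTop.1 (h.eventually_le_const he)
  obtain ⟨n₀, hn₀⟩ := htend hs (show 0 < δ / 2 * (1 - s) by positivity)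
  obtain ⟨k, hk⟩ := htend hs0 (show 0 < δ / 2 * s by positivity)
  refine ⟨n₀, k + 1, k.succ_pos, fun M n h1 h2 => ?_⟩
  have hn : (0 : ℝ) < n := by exact_mod_cast n.pos
  rw [HLPdiscrete_truncatedPower]
  refine le_trans ?_ (le_sum_div_max hs0 hs1 n.pos
    (h2.trans (Nat.le_mul_of_pos_left M k.succ_pos)))
  have hX : 0 < (n : ℝ) ^ (-s) := by positivity
  have hfirst : ((n : ℕ) : ℝ)⁻¹ / (1 - s) ≤ δ / 2 * (n : ℝ) ^ (-s) := by
    have e : ((n : ℕ) : ℝ)⁻¹ = (n : ℝ) ^ (-(1 - s)) * (n : ℝ) ^ (-s) := by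
      rw [← Real.rpow_add hn, show -(1 - s) + -s = -1 by ring, Real.rpow_neg_one]
    rw [div_le_iff₀ hs, e]
    nlinarith [hn₀ n h1]
  have hlast : (((k + 1) * M : ℕ) + 1 : ℝ) ^ (-s) / s ≤ δ / 2 * (n : ℝ) ^ (-s) := by
    have hkn : ((k + 1 : ℕ) : ℝ) * n ≤ ((k + 1) * M : ℕ) + 1 := by
      have : (k + 1) * (n : ℕ) ≤ (k + 1) * M + 1 := (Nat.mul_le_mul_left _ h2).trans (Nat.le_succ _)
      exact_mod_cast this
    have h3 : (((k + 1) * M : ℕ) + 1 : ℝ) ^ (-s) ≤ ((k + 1 : ℕ) : ℝ) ^ (-s) * (n : ℝ) ^ (-s) := by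
      rw [← Real.mul_rpow (by positivity) hn.le]
      exact Real.rpow_le_rpow_of_nonpos (by positivity) hkn (by linarith)
    rw [div_le_iff₀ hs0]
    nlinarith [hk (k + 1) k.le_succ]
  have hsplit : c = 1 / (1 - s) + 1 / s - δ := by rw [δ_def]; ring
  rw [hsplit]
  linarith

theorem sum_range_mul_one_div_le (k M : ℕ) :
    ∑ i ∈ Finset.range (k * M), 1 / ((i : ℝ) + 1)
      ≤ ∑ i ∈ Finset.range M, 1 / ((i : ℝ) + 1) + k := by
  rcases Nat.eq_zero_or_pos M with rfl | hM
  · simp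
  have hM' : (0 : ℝ) < M := by exact_mod_cast hM
  calc ∑ i ∈ Finset.range (k * M), 1 / ((i : ℝ) + 1)
      ≤ ∑ i ∈ Finset.range (M + k * M), 1 / ((i : ℝ) + 1) :=
        Finset.sum_le_sum_of_subset_of_nonneg (Finset.range_subset_range.2 (by omega))
          fun _ _ _ => by positivity
    _ ≤ ∑ i ∈ Finset.range M, 1 / ((i : ℝ) + 1) + ∑ _i ∈ Finset.range (k * M), 1 / (M : ℝ) := by
        rw [Finset.sum_range_add]
        gcongr with i
        push_cast
        linarith [(Nat.cast_nonneg i : (0 : ℝ) ≤ i)]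
    _ = _ := by
        rw [Finset.sum_const, Finset.card_range, nsmul_eq_mul]
        push_cast
        field_simp

theorem exists_mul_lqNorm_le_lqNorm_HLPdiscrete {q q' c : ℝ} (hqq' : q.HolderConjugate q')
    (hc0 : 0 < c)
    (hc : c < q + q') :
    ∃ a : ℕ+ → ℝ, lqNorm q a ≠ ∞ ∧ lqNorm q a ≠ 0 ∧
      ENNReal.ofReal c * lqNorm q a ≤ lqNorm q (HLPdiscrete a) := by
  have hq := hqq'.pos
  obtain ⟨c', hcc', hc'⟩ := exists_between hc
  have hc'0 : 0 < c' := hc0.trans hcc'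
  have hs1 : 1 / q < 1 := by rw [div_lt_one hq]; exact hqq'.lt
  have hconst : 1 / (1 - 1 / q) + 1 / (1 / q) = q + q' := by
    rw [one_div q, hqq'.one_sub_inv]
    simp [add_comm]
  obtain ⟨n₀, k, hk, hlow⟩ := exists_le_HLPdiscrete_truncatedPower (s := 1 / q) (c := c')
    (by positivity) hs1 (by rwa [hconst])
  set H : ℕ → ℝ := fun M => ∑ i ∈ Finset.range M, 1 / ((i : ℝ) + 1) with H_def
  have hcq : c ^ q < c' ^ q := Real.rpow_lt_rpow hc0.le hcc' hq
  obtain ⟨M, hM1, hMn, hM⟩ : ∃ M : ℕ, 1 ≤ M ∧ n₀ ≤ M ∧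
      (c' ^ q * H n₀ + c ^ q * k) / (c' ^ q - c ^ q) ≤ H M :=
    ((Filter.eventually_ge_atTop 1).and ((Filter.eventually_ge_atTop n₀).and
      (Real.tendsto_sum_range_one_div_nat_succ_atTop.eventually_ge_atTop _))).exists
  rw [div_le_iff₀ (sub_pos.2 hcq)] at hM
  have hHpos : 0 < H (k * M) :=
    Finset.sum_pos (fun _ _ => by positivity)
      (Finset.nonempty_range_iff.2 (Nat.mul_pos hk hM1).ne')
  refine ⟨truncatedPower (1 / q) (k * M), ?_, ?_, ?_⟩
  · rw [lqNorm_truncatedPower hq]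
    exact ENNReal.ofReal_ne_top
  · rw [lqNorm_truncatedPower hq, ne_eq, ENNReal.ofReal_eq_zero, not_le]
    exact Real.rpow_pos_of_pos hHpos _
  have hlq := le_lqNorm hq (b := HLPdiscrete (truncatedPower (1 / q) (k * M)))
    (t := Finset.Ico n₀ M) (f := fun i => c' ^ q * (1 / ((i : ℝ) + 1)))
    (fun i _ => by positivity) (fun i hi => by
      rw [Finset.mem_Ico] at hi
      have h := hlow M i.succPNat (by simpa using hi.1.trans i.le_succ) (by simpa using hi.2)
      have e : c' ^ q * (1 / ((i : ℝ) + 1)) = (c' * (i.succPNat : ℝ) ^ (-(1 / q))) ^ q := by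
        rw [Real.mul_rpow hc'0.le (by positivity), ← Real.rpow_mul (by positivity), neg_mul,
          one_div_mul_cancel hq.ne', Real.rpow_neg_one]
        simp
      rw [e]
      exact Real.rpow_le_rpow (by positivity) (h.trans (le_abs_self _)) hq.le)
  refine le_trans ?_ hlq
  rw [lqNorm_truncatedPower hq, ← ENNReal.ofReal_mul hc0.le, ← Finset.mul_sum,
    Finset.sum_Ico_eq_sub _ hMn]
  refine ENNReal.ofReal_le_ofReal ?_
  calc c * H (k * M) ^ (1 / q) = (c ^ q * H (k * M)) ^ (1 / q) := by
        rw [Real.mul_rpow (by positivity) hHpos.le, ← Real.rpow_mul hc0.le,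
          mul_one_div_cancel hq.ne', Real.rpow_one]
    _ ≤ (c' ^ q * (H M - H n₀)) ^ (1 / q) := by
        refine Real.rpow_le_rpow (by positivity) ?_ (by positivity)
        have := mul_le_mul_of_nonneg_left (sum_range_mul_one_div_le k M)
          (Real.rpow_nonneg hc0.le q)
        linarith

/-- For `1 < q < ∞` with conjugate exponent `q'`, the discrete Hardy–Littlewood–Pólya
operator is bounded on `ℓ^q` and its operator norm is `q + q'`. -/
theorem stmt_1 (q q' : ℝ) (hq : 1 < q) (hconj : 1 / q + 1 / q' = 1) :
    (∃ C : ℝ, 0 ≤ C ∧ ∀ a : ℕ+ → ℝ, lqNorm q a ≠ ∞ →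
        lqNorm q (HLPdiscrete a) ≤ ENNReal.ofReal C * lqNorm q a) ∧
    (⨆ a : {a : ℕ+ → ℝ // lqNorm q a ≠ ∞ ∧ lqNorm q a ≠ 0},
        lqNorm q (HLPdiscrete a.1) / lqNorm q a.1) = ENNReal.ofReal (q + q') := by
  have hqq' : q.HolderConjugate q' :=
    Real.holderConjugate_iff.2 ⟨hq, by simpa only [one_div] using hconj⟩
  refine ⟨⟨q + q', add_nonneg hqq'.nonneg hqq'.symm.nonneg,
    fun a _ => lqNorm_HLPdiscrete_le hqq' a⟩, le_antisymm ?_ ?_⟩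
  · exact iSup_le fun a => ENNReal.div_le_of_le_mul (lqNorm_HLPdiscrete_le hqq' a.1)
  · refine le_of_forall_lt_imp_le_of_dense fun x hx => ?_
    rcases eq_or_ne x 0 with rfl | hx0
    · exact zero_le
    have hxt : x ≠ ∞ := hx.ne_top
    obtain ⟨a, ha, ha0, hle⟩ := exists_mul_lqNorm_le_lqNorm_HLPdiscrete hqq'
      (ENNReal.toReal_pos hx0 hxt) ((ENNReal.lt_ofReal_iff_toReal_lt hxt).1 hx)
    rw [ENNReal.ofReal_toReal hxt] at hle
    refine le_trans ?_ (le_iSup (fun a : {a : ℕ+ → ℝ // lqNorm q a ≠ ∞ ∧ lqNorm q a ≠ 0} =>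
      lqNorm q (HLPdiscrete a.1) / lqNorm q a.1) ⟨a, ha, ha0⟩)
    exact (ENNReal.le_div_iff_mul_le (Or.inl ha0) (Or.inl ha)).2 hle
end

section
/- Let a and λ be real numbers and let y ∈ ℚ_p^*. The integral I(y) = ∫_{ℚ_p^*} |x|_p^a / (max{|x|_p, |y|_p})^λ dx converges (is finite) if and only if a > −1 and λ − a − 1 > 0; and when it converges, I(y) = (1 − p^{−1})[1 + 1/(p^{a+1} − 1) + 1/(p^{λ−a−1} − 1)] · |y|_p^{a+1−λ}. -/
open MeasureTheory ENNReal

noncomputable section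

instance (p : ℕ) [Fact p.Prime] : MeasurableSpace ℚ_[p] := borel _
instance (p : ℕ) [Fact p.Prime] : BorelSpace ℚ_[p] := ⟨rfl⟩

/-- `ℚ_p^* = ℚ_p \ {0}`. -/
def Qstar (p : ℕ) [Fact p.Prime] : Set ℚ_[p] := {x : ℚ_[p] | x ≠ 0}

open Metric Set

section PadicMeasure

variable {p : ℕ} [Fact p.Prime]

lemma Padic.closedBall_zpow_add_one_eq_biUnion (n : ℤ) :
    closedBall (0 : ℚ_[p]) ((p : ℝ) ^ (n + 1)) =
      ⋃ i ∈ Finset.range p, closedBall ((i : ℚ_[p]) * (p : ℚ_[p]) ^ (-(n + 1))) ((p : ℝ) ^ n) := by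
  have hp0 : (0 : ℝ) < p := mod_cast (Fact.out : p.Prime).pos
  have hpQ : (p : ℚ_[p]) ≠ 0 := mod_cast (Fact.out : p.Prime).ne_zero
  have hpow : ‖(p : ℚ_[p]) ^ (-(n + 1))‖ = (p : ℝ) ^ (n + 1) := by
    rw [Padic.norm_p_zpow, neg_neg]
  ext x
  simp only [mem_iUnion, mem_closedBall, dist_eq_norm, sub_zero, Finset.mem_range, exists_prop]
  constructor
  · intro hx
    have hz : ‖x * (p : ℚ_[p]) ^ (n + 1)‖ ≤ 1 := by
      rw [norm_mul, Padic.norm_p_zpow, zpow_neg]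
      exact mul_inv_le_one_of_le₀ hx (by positivity)
    let z : ℤ_[p] := ⟨_, hz⟩
    refine ⟨z.zmodRepr, PadicInt.zmodRepr_lt_p z, ?_⟩
    have h1 : ‖x * (p : ℚ_[p]) ^ (n + 1) - (z.zmodRepr : ℚ_[p])‖ < 1 := by
      exact_mod_cast PadicInt.norm_sub_zmodRepr_lt_one z
    have h2 : x - (z.zmodRepr : ℚ_[p]) * (p : ℚ_[p]) ^ (-(n + 1)) =
        (x * (p : ℚ_[p]) ^ (n + 1) - (z.zmodRepr : ℚ_[p])) * (p : ℚ_[p]) ^ (-(n + 1)) := by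
      rw [sub_mul, mul_assoc, ← zpow_add₀ hpQ, add_neg_cancel, zpow_zero, mul_one]
    rw [Padic.norm_le_pow_iff_norm_lt_pow_add_one, h2, norm_mul, hpow]
    exact mul_lt_of_lt_one_left (by positivity) h1
  · rintro ⟨i, -, hx⟩
    rw [← sub_add_cancel x ((i : ℚ_[p]) * (p : ℚ_[p]) ^ (-(n + 1)))]
    refine (Padic.nonarchimedean _ _).trans (max_le (hx.trans ?_) ?_)
    · exact zpow_le_zpow_right₀ (mod_cast (Fact.out : p.Prime).one_le) (by lia)
    · rw [norm_mul, hpow]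
      exact mul_le_of_le_one_left (by positivity) (mod_cast Padic.norm_int_le_one (i : ℤ))

lemma Padic.pairwiseDisjoint_closedBall_natCast_mul_zpow (n : ℤ) :
    (Finset.range p : Set ℕ).PairwiseDisjoint fun i : ℕ ↦
      closedBall ((i : ℚ_[p]) * (p : ℚ_[p]) ^ (-(n + 1))) ((p : ℝ) ^ n) := by
  have hp0 : (0 : ℝ) < p := mod_cast (Fact.out : p.Prime).pos
  intro i hi j hj hij
  refine Set.disjoint_left.2 fun x hx hx' ↦ hij ?_
  simp only [mem_closedBall, dist_eq_norm] at hx hx'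
  have h : ‖((i : ℤ) - (j : ℤ) : ℤ) * (p : ℚ_[p]) ^ (-(n + 1))‖ ≤ (p : ℝ) ^ n := by
    have h0 : ((i : ℤ) - (j : ℤ) : ℤ) * (p : ℚ_[p]) ^ (-(n + 1)) =
        (x - j * (p : ℚ_[p]) ^ (-(n + 1))) - (x - i * (p : ℚ_[p]) ^ (-(n + 1))) := by
      push_cast
      ring
    rw [h0, sub_eq_add_neg]
    exact (Padic.nonarchimedean _ _).trans (max_le hx' (by rwa [norm_neg]))
  rw [Padic.norm_le_pow_iff_norm_lt_pow_add_one, norm_mul, Padic.norm_p_zpow, neg_neg,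
    mul_lt_iff_lt_one_left (by positivity), Padic.norm_intCast_lt_one_iff] at h
  rw [Finset.coe_range, mem_Iio] at hi hj
  have := Int.eq_zero_of_abs_lt_dvd h (by rw [abs_lt]; lia)
  lia

lemma Padic.measure_closedBall_zpow (vol : Measure ℚ_[p]) [vol.IsAddHaarMeasure]
    (hvol : vol {x : ℚ_[p] | ‖x‖ ≤ 1} = 1) (n : ℤ) :
    vol (closedBall 0 ((p : ℝ) ^ n)) = ENNReal.ofReal ((p : ℝ) ^ n) := by
  have hp : (p : ℝ) ≠ 0 := mod_cast (Fact.out : p.Prime).ne_zero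
  have hp0 : (p : ℝ≥0∞) ≠ 0 := mod_cast (Fact.out : p.Prime).ne_zero
  have hpt : (p : ℝ≥0∞) ≠ ∞ := ENNReal.natCast_ne_top p
  have htrans (c : ℚ_[p]) (r : ℝ) : vol (closedBall c r) = vol (closedBall 0 r) := by
    rw [← measure_preimage_add vol c (closedBall c r)]
    congr 1
    ext x
    simp [dist_eq_norm]
  have hstep (n : ℤ) : vol (closedBall 0 ((p : ℝ) ^ (n + 1))) =
      p * vol (closedBall 0 ((p : ℝ) ^ n)) := by
    rw [Padic.closedBall_zpow_add_one_eq_biUnion,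
      measure_biUnion_finset (Padic.pairwiseDisjoint_closedBall_natCast_mul_zpow n)
        fun _ _ ↦ measurableSet_closedBall]
    simp [htrans]
  induction n with
  | zero => simpa [closedBall, dist_eq_norm] using hvol
  | succ n ih =>
    rw [hstep, ih, ← ENNReal.ofReal_natCast, ← ENNReal.ofReal_mul p.cast_nonneg,
      zpow_add_one₀ hp, mul_comm]
  | pred n ih =>
    have h := hstep (-(n : ℤ) - 1)
    rw [sub_add_cancel, ih] at h
    rw [← ENNReal.mul_right_inj hp0 hpt, ← h, ← ENNReal.ofReal_natCast,
      ← ENNReal.ofReal_mul p.cast_nonneg, zpow_sub_one₀ hp, mul_comm, mul_assoc,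
      inv_mul_cancel₀ hp, mul_one]

lemma Padic.measure_sphere_zpow (vol : Measure ℚ_[p]) [vol.IsAddHaarMeasure]
    (hvol : vol {x : ℚ_[p] | ‖x‖ ≤ 1} = 1) (n : ℤ) :
    vol (sphere 0 ((p : ℝ) ^ n)) = ENNReal.ofReal ((1 - (p : ℝ)⁻¹) * (p : ℝ) ^ n) := by
  have hp0 : (0 : ℝ) < p := mod_cast (Fact.out : p.Prime).pos
  have hball := Padic.measure_closedBall_zpow vol hvol
  have hs : sphere (0 : ℚ_[p]) ((p : ℝ) ^ n) =
      closedBall 0 ((p : ℝ) ^ n) \ closedBall 0 ((p : ℝ) ^ (n - 1)) := by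
    ext x
    simp only [mem_sphere, mem_sdiff, mem_closedBall, dist_zero_right,
      ← Padic.norm_lt_pow_iff_norm_le_pow_sub_one, not_lt, le_antisymm_iff]
  rw [hs, measure_sdiff (closedBall_subset_closedBall
      (zpow_le_zpow_right₀ (mod_cast (Fact.out : p.Prime).one_le) (by lia)))
      measurableSet_closedBall.nullMeasurableSet (by simp [hball]), hball, hball,
    ← ENNReal.ofReal_sub _ (by positivity), zpow_sub_one₀ hp0.ne']
  congr 1
  ring

lemma Qstar_eq_iUnion_sphere : Qstar p = ⋃ n : ℤ, sphere 0 ((p : ℝ) ^ n) := by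
  have hp0 : (0 : ℝ) < p := mod_cast (Fact.out : p.Prime).pos
  ext x
  simp only [Qstar, mem_ofPred_eq, mem_iUnion, mem_sphere, dist_zero_right]
  constructor
  · exact fun hx ↦ ⟨_, Padic.norm_eq_zpow_neg_valuation hx⟩
  · rintro ⟨n, hn⟩ rfl
    exact (zpow_pos hp0 n).ne (by simpa using hn)

/-- A radial function integrates over `ℚ_p^*` to the sum over spheres of value times measure. -/
lemma lintegral_Qstar_radial (vol : Measure ℚ_[p]) [vol.IsAddHaarMeasure]
    (hvol : vol {x : ℚ_[p] | ‖x‖ ≤ 1} = 1) (f : ℝ → ℝ≥0∞) :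
    ∫⁻ x in Qstar p, f ‖x‖ ∂vol =
      ∑' n : ℤ, f ((p : ℝ) ^ n) * ENNReal.ofReal ((1 - (p : ℝ)⁻¹) * (p : ℝ) ^ n) := by
  have hp0 : (0 : ℝ) < p := mod_cast (Fact.out : p.Prime).pos
  have hp1 : (p : ℝ) ≠ 1 := mod_cast (Fact.out : p.Prime).ne_one
  have hd : Pairwise (Function.onFun Disjoint fun n : ℤ ↦ sphere (0 : ℚ_[p]) ((p : ℝ) ^ n)) := by
    intro m n hmn
    refine Set.disjoint_left.2 fun x hx hx' ↦ hmn ?_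
    rw [mem_sphere] at hx hx'
    exact zpow_right_injective₀ hp0 hp1 (hx.symm.trans hx')
  rw [Qstar_eq_iUnion_sphere, lintegral_iUnion (fun n ↦ isClosed_sphere.measurableSet) hd]
  refine tsum_congr fun n ↦ ?_
  rw [setLIntegral_congr_fun (g := fun _ ↦ f ((p : ℝ) ^ n)) isClosed_sphere.measurableSet
      fun x hx ↦ by simp only [mem_sphere_zero_iff_norm.1 hx],
    setLIntegral_const, Padic.measure_sphere_zpow vol hvol]

end PadicMeasure

lemma ENNReal.one_sub_inv_ne_top_iff {r : ℝ} : (1 - ENNReal.ofReal r)⁻¹ ≠ ∞ ↔ r < 1 := by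
  rw [Ne, ENNReal.inv_eq_top, tsub_eq_zero_iff_le, not_le, ENNReal.ofReal_lt_one]

lemma ENNReal.one_sub_ofReal_inv {r : ℝ} (h0 : 0 ≤ r) (h1 : r < 1) :
    (1 - ENNReal.ofReal r)⁻¹ = ENNReal.ofReal (1 - r)⁻¹ := by
  rw [ENNReal.ofReal_inv_of_pos (sub_pos.2 h1), ENNReal.ofReal_sub _ h0, ENNReal.ofReal_one]

/-- The integral as a two-sided geometric series, with ratio `p^{a+1-λ}` over the spheres outside
the ball of radius `|y|_p` and ratio `p^{-(a+1)}` over those inside. -/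
lemma lintegral_Qstar_eq_geometric {p : ℕ} [Fact p.Prime] (vol : Measure ℚ_[p])
    [vol.IsAddHaarMeasure] (hvol : vol {x : ℚ_[p] | ‖x‖ ≤ 1} = 1)
    (a lam : ℝ) {y : ℚ_[p]} (hy : y ≠ 0) :
    ∫⁻ x in Qstar p, ENNReal.ofReal (‖x‖ ^ a / (max ‖x‖ ‖y‖) ^ lam) ∂vol =
      ENNReal.ofReal ((1 - (p : ℝ)⁻¹) * ‖y‖ ^ (a + 1 - lam)) *
        ((1 - ENNReal.ofReal ((p : ℝ) ^ (a + 1 - lam)))⁻¹ +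
          ENNReal.ofReal ((p : ℝ) ^ (-(a + 1))) *
            (1 - ENNReal.ofReal ((p : ℝ) ^ (-(a + 1))))⁻¹) := by
  have hp0 : (0 : ℝ) < p := mod_cast (Fact.out : p.Prime).pos
  have hp1 : (1 : ℝ) ≤ p := mod_cast (Fact.out : p.Prime).one_le
  have hc : 0 ≤ 1 - (p : ℝ)⁻¹ := sub_nonneg.2 (inv_le_one_of_one_le₀ hp1)
  obtain ⟨m, hm⟩ : ∃ m : ℤ, ‖y‖ = (p : ℝ) ^ m := ⟨_, Padic.norm_eq_zpow_neg_valuation hy⟩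
  rw [lintegral_Qstar_radial vol hvol fun t ↦ ENNReal.ofReal (t ^ a / (max t ‖y‖) ^ lam), hm,
    ← (Equiv.addLeft m).tsum_eq,
    tsum_of_nat_of_neg_add_one ENNReal.summable ENNReal.summable,
    ← ENNReal.tsum_geometric_add_one, ← ENNReal.tsum_geometric, mul_add,
    ← ENNReal.tsum_mul_left, ← ENNReal.tsum_mul_left]
  congr 1 <;> refine tsum_congr fun k ↦ ?_
  · have hmax : max ((p : ℝ) ^ (m + k : ℤ)) ((p : ℝ) ^ m) = (p : ℝ) ^ (m + k : ℤ) :=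
      max_eq_left (zpow_le_zpow_right₀ hp1 (by lia))
    rw [Equiv.coe_addLeft, hmax, ← ENNReal.ofReal_mul (by positivity),
      ← ENNReal.ofReal_pow (by positivity), ← ENNReal.ofReal_mul (by positivity)]
    congr 1
    simp only [← Real.rpow_intCast, ← Real.rpow_natCast, ← Real.rpow_mul hp0.le]
    rw [← Real.rpow_sub hp0, mul_left_comm, ← Real.rpow_add hp0, mul_assoc, ← Real.rpow_add hp0]
    congr 2
    push_cast
    ring
  · have hmax : max ((p : ℝ) ^ (m + -(k + 1) : ℤ)) ((p : ℝ) ^ m) = (p : ℝ) ^ m :=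
      max_eq_right (zpow_le_zpow_right₀ hp1 (by lia))
    rw [Equiv.coe_addLeft, hmax, ← ENNReal.ofReal_mul (by positivity),
      ← ENNReal.ofReal_pow (by positivity), ← ENNReal.ofReal_mul (by positivity)]
    congr 1
    simp only [← Real.rpow_intCast, ← Real.rpow_natCast, ← Real.rpow_mul hp0.le]
    rw [← Real.rpow_sub hp0, mul_left_comm, ← Real.rpow_add hp0, mul_assoc, ← Real.rpow_add hp0]
    congr 2
    push_cast
    ring

/-- For real `a, λ` and `y ∈ ℚ_p^*`, the integral
`I(y) = ∫_{ℚ_p^*} |x|_p^a / (max{|x|_p,|y|_p})^λ dx` is finite iff `a > −1` and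
`λ − a − 1 > 0`, in which case
`I(y) = (1 − p⁻¹)[1 + 1/(p^{a+1} − 1) + 1/(p^{λ−a−1} − 1)] |y|_p^{a+1−λ}`. -/
theorem stmt_12 (p : ℕ) [Fact p.Prime] (vol : Measure ℚ_[p]) [vol.IsAddHaarMeasure]
    (hvol : vol {x : ℚ_[p] | ‖x‖ ≤ 1} = 1)
    (a lam : ℝ) (y : ℚ_[p]) (hy : y ≠ 0) :
    ((∫⁻ x in Qstar p, ENNReal.ofReal (‖x‖ ^ a / (max ‖x‖ ‖y‖) ^ lam) ∂vol) ≠ ∞ ↔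
      (-1 < a ∧ 0 < lam - a - 1)) ∧
    ((-1 < a ∧ 0 < lam - a - 1) →
      (∫⁻ x in Qstar p, ENNReal.ofReal (‖x‖ ^ a / (max ‖x‖ ‖y‖) ^ lam) ∂vol) =
        ENNReal.ofReal ((1 - (p : ℝ)⁻¹) *
          (1 + 1 / ((p : ℝ) ^ (a + 1) - 1) + 1 / ((p : ℝ) ^ (lam - a - 1) - 1)) *
            ‖y‖ ^ (a + 1 - lam))) := by
  have hp1 : (1 : ℝ) < p := mod_cast (Fact.out : p.Prime).one_lt
  have hp0 : (0 : ℝ) < p := one_pos.trans hp1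
  have hc : 0 < 1 - (p : ℝ)⁻¹ := sub_pos.2 (inv_lt_one_of_one_lt₀ hp1)
  have hy0 : 0 < ‖y‖ := norm_pos_iff.2 hy
  have hr : (p : ℝ) ^ (a + 1 - lam) < 1 ↔ 0 < lam - a - 1 := by
    rw [← Real.rpow_zero p, Real.rpow_lt_rpow_left_iff hp1]
    constructor <;> intro h <;> linarith
  have hs : (p : ℝ) ^ (-(a + 1)) < 1 ↔ -1 < a := by
    rw [← Real.rpow_zero p, Real.rpow_lt_rpow_left_iff hp1]
    constructor <;> intro h <;> linarith
  have hr0 : 0 < (p : ℝ) ^ (a + 1 - lam) := Real.rpow_pos_of_pos hp0 _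
  have hs0 : 0 < (p : ℝ) ^ (-(a + 1)) := Real.rpow_pos_of_pos hp0 _
  have hC : ENNReal.ofReal ((1 - (p : ℝ)⁻¹) * ‖y‖ ^ (a + 1 - lam)) ≠ 0 :=
    (ENNReal.ofReal_pos.2 (by positivity)).ne'
  have hr' : (p : ℝ) ^ (lam - a - 1) = ((p : ℝ) ^ (a + 1 - lam))⁻¹ := by
    rw [← Real.rpow_neg hp0.le]
    ring_nf
  have hs' : (p : ℝ) ^ (a + 1) = ((p : ℝ) ^ (-(a + 1)))⁻¹ := by
    rw [← Real.rpow_neg hp0.le, neg_neg]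
  rw [lintegral_Qstar_eq_geometric vol hvol a lam hy, ← hr, ← hs, hr', hs']
  generalize (p : ℝ) ^ (a + 1 - lam) = r at *
  generalize (p : ℝ) ^ (-(a + 1)) = s at *
  have key (h : s < 1 ∧ r < 1) :
      ENNReal.ofReal ((1 - (p : ℝ)⁻¹) * ‖y‖ ^ (a + 1 - lam)) *
        ((1 - ENNReal.ofReal r)⁻¹ + ENNReal.ofReal s * (1 - ENNReal.ofReal s)⁻¹) =
      ENNReal.ofReal ((1 - (p : ℝ)⁻¹) * (1 + 1 / (s⁻¹ - 1) + 1 / (r⁻¹ - 1)) *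
        ‖y‖ ^ (a + 1 - lam)) := by
    have h1 : 0 < 1 - s := sub_pos.2 h.1
    have h2 : 0 < 1 - r := sub_pos.2 h.2
    rw [ENNReal.one_sub_ofReal_inv hr0.le h.2, ENNReal.one_sub_ofReal_inv hs0.le h.1,
      ← ENNReal.ofReal_mul hs0.le, ← ENNReal.ofReal_add (by positivity) (by positivity),
      ← ENNReal.ofReal_mul (by positivity), mul_right_comm]
    have e1 : 1 / (s⁻¹ - 1) = s * (1 - s)⁻¹ := by
      have : s⁻¹ - 1 = (1 - s) / s := by field_simp
      rw [this]
      field_simp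
    have e2 : 1 + 1 / (r⁻¹ - 1) = (1 - r)⁻¹ := by
      have : r⁻¹ - 1 = (1 - r) / r := by field_simp
      rw [this]
      field_simp
      ring
    rw [add_right_comm, e1, e2, mul_right_comm]
  refine ⟨⟨fun h ↦ ?_, fun h ↦ key h ▸ ENNReal.ofReal_ne_top⟩, key⟩
  rw [← ENNReal.one_sub_inv_ne_top_iff (r := s), ← ENNReal.one_sub_inv_ne_top_iff (r := r)]
  refine ⟨fun hs1 ↦ h ?_, fun hr1 ↦ h ?_⟩
  · rw [hs1, ENNReal.mul_top (ENNReal.ofReal_pos.2 hs0).ne', add_top, ENNReal.mul_top hC]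
  · rw [hr1, top_add, ENNReal.mul_top hC]
end
end
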